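/- In the chain of loops Γ₀ (with the marked points v_g ∈ γ₁ and v_{g−1} ∈ γ_a): every effective divisor on Γ₀ is linearly equivalent on Γ₀ to an effective divisor whose support contains at most one point of γ_i \ {w_i} for each 1 ≤ i ≤ a, where by convention w_a := v_{g−1}. -/

import Mathlib

noncomputable section

/-- The star with `n` rays of radius `r` in the complex plane:
`{ z ∈ ℂ : z = t·e^{2πik/n}, t ∈ [0,r], k ∈ ℤ }`. -/
def starSet (n : ℕ) (r : ℝ) : Set ℂ :=
  {z | ∃ t ∈ Set.Icc (0 : ℝ) r, ∃ k : ℤ,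
    z = (t : ℂ) * Complex.exp (2 * (Real.pi : ℂ) * Complex.I * (k : ℂ) / (n : ℂ))}

/-- `P` has a neighbourhood isometric to a star with `n` rays of some radius `r > 0`,
with `P` corresponding to `0`. -/
def HasStarNbhd (Γ : Type*) [MetricSpace Γ] (P : Γ) (n : ℕ) : Prop :=
  ∃ r > (0 : ℝ), ∃ U ∈ nhds P, ∃ φ : Γ → ℂ,
    φ P = 0 ∧ φ '' U = starSet n r ∧
    ∀ x ∈ U, ∀ y ∈ U, dist (φ x) (φ y) = dist x y

/-- A metric graph: a compact connected metric space in which every point has a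
neighbourhood isometric to a star with `n ≥ 1` rays. -/
def IsMetricGraph (Γ : Type*) [MetricSpace Γ] : Prop :=
  CompactSpace Γ ∧ ConnectedSpace Γ ∧ ∀ P : Γ, ∃ n : ℕ, 1 ≤ n ∧ HasStarNbhd Γ P n

/-- The valence of a point: the number of rays of a star neighbourhood. -/
noncomputable def valence (Γ : Type*) [MetricSpace Γ] (P : Γ) : ℕ :=
  sInf {n : ℕ | 1 ≤ n ∧ HasStarNbhd Γ P n}

/-- A vertex is a point of valence different from `2`. -/
def IsVertex (Γ : Type*) [MetricSpace Γ] (P : Γ) : Prop := valence Γ P ≠ 2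

/-- The genus of a metric graph: `#edges - #vertices + 1`, the edges being the connected
components of the complement of the vertex set. -/
noncomputable def graphGenus (Γ : Type*) [MetricSpace Γ] : ℤ :=
  (Nat.card (ConnectedComponents {P : Γ // ¬ IsVertex Γ P}) : ℤ)
    - (Nat.card {P : Γ // IsVertex Γ P} : ℤ) + 1

/-- A divisor on `Γ` : a finitely supported formal `ℤ`-linear combination of points. -/
abbrev Divisor (Γ : Type*) : Type _ := Γ →₀ ℤ

/-- The degree of a divisor. -/
def divDeg {Γ : Type*} (D : Divisor Γ) : ℤ := D.sum fun _ n => n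

/-- A divisor is effective if all its coefficients are nonnegative. -/
def Effective {Γ : Type*} (D : Divisor Γ) : Prop := ∀ P : Γ, 0 ≤ D P

/-- An arc based at `P` : an isometric parametrization of a segment emanating from `P`. -/
def IsArcAt {Γ : Type*} [MetricSpace Γ] (P : Γ) (τ : ℝ → Γ) : Prop :=
  τ 0 = P ∧ ∃ a > (0 : ℝ), ∀ s ∈ Set.Icc (0 : ℝ) a, ∀ t ∈ Set.Icc (0 : ℝ) a,
    dist (τ s) (τ t) = |s - t|

/-- Two arcs are equivalent (define the same tangent direction) when they agree near `0`. -/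
def ArcEquiv {Γ : Type*} (τ τ' : ℝ → Γ) : Prop :=
  ∃ ε > (0 : ℝ), ∀ t ∈ Set.Icc (0 : ℝ) ε, τ t = τ' t

/-- `f` has (one-sided) slope `s` along the arc `τ`. -/
def HasSlopeAlong {Γ : Type*} (f : Γ → ℝ) (τ : ℝ → Γ) (s : ℤ) : Prop :=
  ∃ ε > (0 : ℝ), ∀ t ∈ Set.Icc (0 : ℝ) ε, f (τ t) = f (τ 0) + (s : ℝ) * t

/-- A rational function on a metric graph: continuous and piecewise affine with
integer slopes, i.e. having an integer slope along every arc. -/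
def IsRational (Γ : Type*) [MetricSpace Γ] (f : Γ → ℝ) : Prop :=
  Continuous f ∧ ∀ (P : Γ) (τ : ℝ → Γ), IsArcAt P τ → ∃ s : ℤ, HasSlopeAlong f τ s

/-- `div f` has coefficient `m` at `P`: the sum of the slopes of `f` in all tangent
directions emanating from `P` equals `m`. -/
def HasOrderAt (Γ : Type*) [MetricSpace Γ] (f : Γ → ℝ) (P : Γ) (m : ℤ) : Prop :=
  ∃ (n : ℕ) (τ : Fin n → ℝ → Γ) (s : Fin n → ℤ),
    (∀ i, IsArcAt P (τ i)) ∧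
    Pairwise (fun i j => ¬ ArcEquiv (τ i) (τ j)) ∧
    (∀ σ : ℝ → Γ, IsArcAt P σ → ∃ i, ArcEquiv σ (τ i)) ∧
    (∀ i, HasSlopeAlong f (τ i) (s i)) ∧
    m = ∑ i, s i

/-- Linear equivalence of divisors: `D₂ - D₁ = div f` for some rational function `f`. -/
def LinEquiv (Γ : Type*) [MetricSpace Γ] (D₁ D₂ : Divisor Γ) : Prop :=
  ∃ f : Γ → ℝ, IsRational Γ f ∧ ∀ P : Γ, HasOrderAt Γ f P (D₂ P - D₁ P)

/-- `D` is linearly equivalent to an effective divisor. -/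
def EquivEffective (Γ : Type*) [MetricSpace Γ] (D : Divisor Γ) : Prop :=
  ∃ D' : Divisor Γ, Effective D' ∧ LinEquiv Γ D D'

/-- For every effective divisor `E` of degree `r`, `D - E` is linearly equivalent to an
effective divisor. -/
def RankGE (Γ : Type*) [MetricSpace Γ] (D : Divisor Γ) (r : ℕ) : Prop :=
  ∀ E : Divisor Γ, Effective E → divDeg E = (r : ℤ) → EquivEffective Γ (D - E)

/-- The rank of a divisor: `-1` if `D` is not equivalent to an effective divisor, and
otherwise the largest `r ≥ 0` such that `D - E` is equivalent to an effective divisor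
for every effective `E` of degree `r`. -/
noncomputable def divRank (Γ : Type*) [MetricSpace Γ] (D : Divisor Γ) : ℤ :=
  sSup (insert (-1) {n : ℤ | ∃ r : ℕ, n = (r : ℤ) ∧ RankGE Γ D r})

/-- The arc `τ` immediately leaves the set `X`. -/
def ArcLeaves {Γ : Type*} (X : Set Γ) (τ : ℝ → Γ) : Prop :=
  ∃ ε > (0 : ℝ), ∀ t ∈ Set.Ioc (0 : ℝ) ε, τ t ∉ X

/-- `P` is a non-saturated boundary point of `X` with respect to `D` : the number of
tangent directions at `P` leaving `X` is strictly greater than `D P`. -/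
def NonSaturated (Γ : Type*) [MetricSpace Γ] (D : Divisor Γ) (X : Set Γ) (P : Γ) : Prop :=
  P ∈ frontier X ∧ ∃ (n : ℕ) (τ : Fin n → ℝ → Γ),
    (∀ i, IsArcAt P (τ i)) ∧ (∀ i, ArcLeaves X (τ i)) ∧
    Pairwise (fun i j => ¬ ArcEquiv (τ i) (τ j)) ∧ D P < (n : ℤ)

/-- `D` is `P₀`-reduced. -/
def IsReducedDivisor (Γ : Type*) [MetricSpace Γ] (D : Divisor Γ) (P₀ : Γ) : Prop :=
  (∀ P : Γ, P ≠ P₀ → 0 ≤ D P) ∧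
  ∀ X : Set Γ, IsClosed X → X.Nonempty → P₀ ∉ X → ∃ P, NonSaturated Γ D X P

/-- The restriction of a divisor on `Γ` to a divisor on a subset `S` (with the induced
metric); divisors supported on `S` are identified with divisors on `S` this way. -/
noncomputable def DivRestrict {Γ : Type*} (S : Set Γ) (D : Divisor Γ) : Divisor ↥S :=
  Finsupp.comapDomain Subtype.val D Subtype.coe_injective.injOn

/-- Linear equivalence computed on the subgraph `S` of `Γ`. -/
def LinEquivOn {Γ : Type*} [MetricSpace Γ] (S : Set Γ) (D₁ D₂ : Divisor Γ) : Prop :=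
  LinEquiv ↥S (DivRestrict S D₁) (DivRestrict S D₂)

/-- The rank computed on the subgraph `S` of `Γ`. -/
noncomputable def divRankOn {Γ : Type*} [MetricSpace Γ] (S : Set Γ) (D : Divisor Γ) : ℤ :=
  divRank ↥S (DivRestrict S D)

/-- A free divisor: effective, of rank at least one, and removing any point decreases
the rank. -/
def IsFreeDivisor (Γ : Type*) [MetricSpace Γ] (D : Divisor Γ) : Prop :=
  Effective D ∧ 1 ≤ divRank Γ D ∧
  ∀ P : Γ, divRank Γ (D - Finsupp.single P 1) < divRank Γ D

/-- The canonical divisor `K_Γ = Σ_P (val(P) - 2)·P`. -/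
def IsCanonical (Γ : Type*) [MetricSpace Γ] (K : Divisor Γ) : Prop :=
  ∀ P : Γ, K P = (valence Γ P : ℤ) - 2

/-- A very special divisor: effective with `rk(D) > 0` and `rk(K_Γ - D) > 0`. -/
def VerySpecial (Γ : Type*) [MetricSpace Γ] (D : Divisor Γ) : Prop :=
  Effective D ∧ 0 < divRank Γ D ∧
  ∃ K : Divisor Γ, IsCanonical Γ K ∧ 0 < divRank Γ (K - D)

/-- `φ` is an `L`-periodic locally isometric parametrization of the circle `S ⊆ Γ`
of circumference `L`. -/
def CircleParam {Γ : Type*} [MetricSpace Γ] (S : Set Γ) (L : ℝ) (φ : ℝ → Γ) : Prop :=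
  0 < L ∧ (∀ t : ℝ, φ (t + L) = φ t) ∧ Set.range φ = S ∧
  ∀ s t : ℝ, |s - t| ≤ L / 2 → dist (φ s) (φ t) = |s - t|

/-- `S` is a metric circle inside `Γ`. -/
def IsCircleSet {Γ : Type*} [MetricSpace Γ] (S : Set Γ) : Prop :=
  ∃ (L : ℝ) (φ : ℝ → Γ), CircleParam S L φ

end
/-- A bundled metric graph. -/
structure MetricGraph : Type 1 where
  carrier : Type
  [ms : MetricSpace carrier]
  graph : IsMetricGraph carrier

attribute [instance] MetricGraph.ms

/-- A metric graph `G` obtained from a metric graph `G₀` by attaching a loop `γ`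
(a metric circle) at a point `v ∈ G₀`. -/
structure LoopAttachment : Type 1 where
  G : Type
  [ms : MetricSpace G]
  graph : IsMetricGraph G
  G₀ : Set G
  γ : Set G
  v : G
  hv : v ∈ G₀
  closed₀ : IsClosed G₀
  closedγ : IsClosed γ
  cover : G₀ ∪ γ = Set.univ
  meet : G₀ ∩ γ = {v}
  graph₀ : IsMetricGraph ↥G₀
  circleγ : IsCircleSet γ

attribute [instance] LoopAttachment.ms
/-- A chain of `a` loops `γ₁, …, γ_a` with consecutive loops meeting in the points
`w₁, …, w_{a-1}`, together with marked points `vg ∈ γ₁ \ {w₁}` and `vg' ∈ γ_a \ {w_{a-1}}`. -/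
structure ChainOfLoops (a : ℕ) : Type 1 where
  ha : 1 ≤ a
  Γ : Type
  [ms : MetricSpace Γ]
  graph : IsMetricGraph Γ
  loop : ℕ → Set Γ
  w : ℕ → Γ
  vg : Γ
  vg' : Γ
  circle : ∀ i ∈ Finset.Icc 1 a, IsCircleSet (loop i)
  closedLoop : ∀ i ∈ Finset.Icc 1 a, IsClosed (loop i)
  cover : (⋃ i ∈ Finset.Icc 1 a, loop i) = Set.univ
  chainMeet : ∀ i ∈ Finset.Icc 1 (a - 1), loop i ∩ loop (i + 1) = {w i}
  chainDisj : ∀ i ∈ Finset.Icc 1 a, ∀ j ∈ Finset.Icc 1 a, i + 2 ≤ j → loop i ∩ loop j = ∅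
  hvg : vg ∈ loop 1
  hvg' : vg' ∈ loop a
  hvgw : 2 ≤ a → vg ≠ w 1
  hvg'w : 2 ≤ a → vg' ≠ w (a - 1)

attribute [instance] ChainOfLoops.ms

/-- The chain-plus-loops graph: a chain `Γ₀` of `a` loops (with the genericity condition
that the two edges joining `w_i` to `w_{i+1}` have different lengths), marked points
`v_{a+1}, …, v_g` on `Γ₀` (with `v_g ∈ γ₁ \ {w₁}`, `2v_g ≁ 2w₁` on `γ₁`, and
`v_{g-1} ∈ γ_a \ {w_{a-1}}`, `2v_{g-1} ≁ 2w_{a-1}` on `γ_a`), and a loop `γ_i`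
attached at `v_i` for each `a + 1 ≤ i ≤ g`. -/
structure ChainPlusLoops (a g : ℕ) : Type 1 where
  ha : 1 ≤ a
  hg : a + 3 ≤ g
  Γ : Type
  [ms : MetricSpace Γ]
  graph : IsMetricGraph Γ
  loop : ℕ → Set Γ
  w : ℕ → Γ
  v : ℕ → Γ
  Γ₀ : Set Γ
  hΓ₀ : Γ₀ = ⋃ i ∈ Finset.Icc 1 a, loop i
  circle : ∀ i ∈ Finset.Icc 1 g, IsCircleSet (loop i)
  closedLoop : ∀ i ∈ Finset.Icc 1 g, IsClosed (loop i)
  chainMeet : ∀ i ∈ Finset.Icc 1 (a - 1), loop i ∩ loop (i + 1) = {w i}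
  chainDisj : ∀ i ∈ Finset.Icc 1 a, ∀ j ∈ Finset.Icc 1 a, i + 2 ≤ j → loop i ∩ loop j = ∅
  edgeLengths : ∀ i ∈ Finset.Icc 1 (a - 2), ∃ (L : ℝ) (φ : ℝ → Γ) (l : ℝ),
    CircleParam (loop (i + 1)) L φ ∧ φ 0 = w i ∧ 0 < l ∧ l < L ∧ φ l = w (i + 1) ∧ 2 * l ≠ L
  cover : Γ₀ ∪ (⋃ i ∈ Finset.Icc (a + 1) g, loop i) = Set.univ
  hvg : v g ∈ loop 1
  hvg' : v (g - 1) ∈ loop a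
  hvgw : 2 ≤ a → v g ≠ w 1
  hvg'w : 2 ≤ a → v (g - 1) ≠ w (a - 1)
  vgGeneric : 2 ≤ a →
    ¬ LinEquivOn (loop 1) (Finsupp.single (v g) 2) (Finsupp.single (w 1) 2)
  vg'Generic : 2 ≤ a →
    ¬ LinEquivOn (loop a) (Finsupp.single (v (g - 1)) 2) (Finsupp.single (w (a - 1)) 2)
  hvMem : ∀ i ∈ Finset.Icc (a + 1) g, v i ∈ Γ₀
  hvInj : ∀ i ∈ Finset.Icc (a + 1) g, ∀ j ∈ Finset.Icc (a + 1) g, i ≠ j → v i ≠ v j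
  hvw : ∀ i ∈ Finset.Icc (a + 1) g, ∀ k ∈ Finset.Icc 1 (a - 1), v i ≠ w k
  attachMeet : ∀ i ∈ Finset.Icc (a + 1) g, loop i ∩ Γ₀ = {v i}
  attachDisj : ∀ i ∈ Finset.Icc (a + 1) g, ∀ j ∈ Finset.Icc (a + 1) g, i ≠ j →
    loop i ∩ loop j = ∅
  graph₀ : IsMetricGraph ↥Γ₀
  hGenus : graphGenus Γ = (g : ℤ)

attribute [instance] ChainPlusLoops.ms

section ChainOfLoopsReduction

open Filter Topology Set

section Arcs

variable {Γ : Type*}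

theorem arcEquiv_iff_eventually {τ τ' : ℝ → Γ} :
    ArcEquiv τ τ' ↔ ∀ᶠ t in 𝓝[≥] (0 : ℝ), τ t = τ' t :=
  mem_nhdsGE_iff_exists_Icc_subset.symm

theorem hasSlopeAlong_iff_eventually {f : Γ → ℝ} {τ : ℝ → Γ} {s : ℤ} :
    HasSlopeAlong f τ s ↔ ∀ᶠ t in 𝓝[≥] (0 : ℝ), f (τ t) = f (τ 0) + (s : ℝ) * t :=
  mem_nhdsGE_iff_exists_Icc_subset.symm

theorem ArcEquiv.symm {τ τ' : ℝ → Γ} (h : ArcEquiv τ τ') : ArcEquiv τ' τ := by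
  rw [arcEquiv_iff_eventually] at *
  exact h.mono fun _ ht => ht.symm

theorem ArcEquiv.trans {τ τ' τ'' : ℝ → Γ} (h : ArcEquiv τ τ') (h' : ArcEquiv τ' τ'') :
    ArcEquiv τ τ'' := by
  rw [arcEquiv_iff_eventually] at *
  filter_upwards [h, h'] with t ht ht' using ht.trans ht'

theorem HasSlopeAlong.congr_arc {f : Γ → ℝ} {τ τ' : ℝ → Γ} {s : ℤ}
    (hf : HasSlopeAlong f τ s) (h : ArcEquiv τ τ') : HasSlopeAlong f τ' s := by
  rw [hasSlopeAlong_iff_eventually] at *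
  rw [arcEquiv_iff_eventually] at h
  have h0 : τ 0 = τ' 0 := h.self_of_nhdsWithin self_mem_Ici
  filter_upwards [hf, h] with t ht ht'
  rw [← ht', ← h0, ht]

theorem HasSlopeAlong.add {f g : Γ → ℝ} {τ : ℝ → Γ} {s s' : ℤ}
    (hf : HasSlopeAlong f τ s) (hg : HasSlopeAlong g τ s') :
    HasSlopeAlong (f + g) τ (s + s') := by
  rw [hasSlopeAlong_iff_eventually] at *
  filter_upwards [hf, hg] with t ht ht'
  simp only [Pi.add_apply, ht, ht']
  push_cast
  ring

/-- The two directions on the circle at the point of parameter `x`. -/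
def circleBranch (φ : ℝ → Γ) (x : ℝ) (b : Bool) (s : ℝ) : Γ := φ (x + bif b then s else -s)

theorem circleBranch_zero (φ : ℝ → Γ) (x : ℝ) (b : Bool) : circleBranch φ x b 0 = φ x := by
  cases b <;> simp [circleBranch]

variable [MetricSpace Γ]

theorem HasOrderAt.add {f g : Γ → ℝ} {P : Γ} {m m' : ℤ}
    (hf : HasOrderAt Γ f P m) (hg : HasOrderAt Γ g P m') :
    HasOrderAt Γ (f + g) P (m + m') := by
  obtain ⟨n, τ, s, hτ, hne, hall, hs, rfl⟩ := hf
  obtain ⟨n', τ', s', hτ', hne', hall', hs', rfl⟩ := hg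
  choose e he using fun i => hall' (τ i) (hτ i)
  have hinj : Function.Injective e := fun i j hij => by
    by_contra h
    exact hne h ((he i).trans (hij ▸ (he j).symm))
  have hsurj : Function.Surjective e := fun j => by
    obtain ⟨i, hi⟩ := hall (τ' j) (hτ' j)
    refine ⟨i, ?_⟩
    by_contra h
    exact hne' h ((hi.trans (he i)).symm)
  refine ⟨n, τ, fun i => s i + s' (e i), hτ, hne, hall,
    fun i => (hs i).add ((hs' (e i)).congr_arc (he i).symm), ?_⟩
  rw [Finset.sum_add_distrib, Function.Bijective.sum_comp ⟨hinj, hsurj⟩ s']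

theorem isRational_of_hasOrderAt {f : Γ → ℝ} (hc : Continuous f)
    (h : ∀ P, ∃ m, HasOrderAt Γ f P m) : IsRational Γ f := by
  refine ⟨hc, fun P σ hσ => ?_⟩
  obtain ⟨_, n, τ, s, -, -, hall, hs, -⟩ := h P
  obtain ⟨i, hi⟩ := hall σ hσ
  exact ⟨s i, (hs i).congr_arc hi.symm⟩

theorem LinEquiv.trans {D₁ D₂ D₃ : Divisor Γ} (h : LinEquiv Γ D₁ D₂)
    (h' : LinEquiv Γ D₂ D₃) : LinEquiv Γ D₁ D₃ := by
  obtain ⟨f, hf, hfo⟩ := h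
  obtain ⟨g, hg, hgo⟩ := h'
  have ho : ∀ P, HasOrderAt Γ (f + g) P (D₃ P - D₁ P) := fun P => by
    have := (hfo P).add (hgo P)
    rwa [show D₂ P - D₁ P + (D₃ P - D₂ P) = D₃ P - D₁ P by ring] at this
  exact ⟨f + g, isRational_of_hasOrderAt (hf.1.add hg.1) fun P => ⟨_, ho P⟩, ho⟩

end Arcs

section Circle

variable {Γ : Type*} [MetricSpace Γ] {S : Set Γ} {L : ℝ} {φ : ℝ → Γ}

theorem IsCircleSet.exists_param_eq (h : IsCircleSet S) {b : Γ} (hb : b ∈ S) :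
    ∃ (L : ℝ) (φ : ℝ → Γ), CircleParam S L φ ∧ φ 0 = b := by
  obtain ⟨L, φ, hL, hper, hr, hd⟩ := h
  obtain ⟨t₀, rfl⟩ : b ∈ range φ := hr ▸ hb
  refine ⟨L, fun t => φ (t₀ + t), ⟨hL, fun t => ?_, ?_, fun s t hst => ?_⟩, by simp⟩
  · simp only [← add_assoc, hper]
  · rw [← hr]
    exact (Equiv.addLeft t₀).surjective.range_comp φ
  · rw [hd _ _ (by simpa using hst)]
    simp

theorem CircleParam.periodic (h : CircleParam S L φ) : Function.Periodic φ L := h.2.1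

theorem CircleParam.mem (h : CircleParam S L φ) (t : ℝ) : φ t ∈ S :=
  h.2.2.1 ▸ mem_range_self t

theorem CircleParam.continuous (h : CircleParam S L φ) : Continuous φ := by
  obtain ⟨hL, -, -, hd⟩ := h
  refine Metric.continuous_iff.2 fun b ε hε => ⟨min ε (L / 2), by positivity, fun x hx => ?_⟩
  rw [Real.dist_eq, lt_min_iff] at hx
  rw [hd _ _ hx.2.le]
  exact hx.1

theorem CircleParam.exists_mem_Ico (h : CircleParam S L φ) {P : Γ} (hP : P ∈ S) (a : ℝ) :
    ∃ t ∈ Ico a (a + L), φ t = P := by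
  obtain ⟨t, rfl⟩ : P ∈ range φ := h.2.2.1 ▸ hP
  obtain ⟨y, hy, hty⟩ := h.periodic.exists_mem_Ico h.1 t a
  exact ⟨y, hy, hty.symm⟩

theorem CircleParam.image_Icc (h : CircleParam S L φ) : φ '' Icc 0 L = S := by
  rw [← h.2.2.1, ← h.periodic.image_Icc h.1 0, zero_add]

theorem CircleParam.isClosed (h : CircleParam S L φ) : IsClosed S :=
  h.image_Icc ▸ (isCompact_Icc.image h.continuous).isClosed

theorem CircleParam.injOn (h : CircleParam S L φ) : InjOn φ (Ico 0 L) := by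
  obtain ⟨hL, hper, -, hd⟩ := h
  have key : ∀ s ∈ Ico 0 L, ∀ t ∈ Ico 0 L, s ≤ t → φ s = φ t → s = t := by
    intro s hs t ht hst he
    rcases le_total (t - s) (L / 2) with h2 | h2
    · have := hd s t (by rw [abs_sub_comm, abs_of_nonneg] <;> linarith)
      rw [he, dist_self, eq_comm, abs_eq_zero] at this
      linarith
    · have hpos : 0 ≤ s + L - t := by linarith [hs.1, ht.2]
      have := hd (s + L) t (by rw [abs_of_nonneg hpos]; linarith)
      rw [hper, he, dist_self, abs_of_nonneg hpos] at this
      linarith [hs.1, ht.2]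
  intro s hs t ht he
  rcases le_total s t with hst | hst
  · exact key s hs t ht hst he
  · exact (key t ht s hs hst he.symm).symm

theorem CircleParam.circleBranch_mem (h : CircleParam S L φ) (x : ℝ) (b : Bool) (s : ℝ) :
    circleBranch φ x b s ∈ S := h.mem _

theorem CircleParam.continuous_circleBranch (h : CircleParam S L φ) (x : ℝ) (b : Bool) :
    Continuous (circleBranch φ x b) := by
  have := h.continuous
  cases b <;> unfold circleBranch <;> simp only [cond_true, cond_false] <;> fun_prop

theorem CircleParam.dist_circleBranch (h : CircleParam S L φ) (x : ℝ) (b : Bool) {s t : ℝ}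
    (hst : |s - t| ≤ L / 2) : dist (circleBranch φ x b s) (circleBranch φ x b t) = |s - t| := by
  cases b
  · simp only [circleBranch, cond_false]
    rw [h.2.2.2 _ _ (by rwa [abs_sub_comm, show x + -t - (x + -s) = s - t by ring])]
    rw [abs_sub_comm]
    congr 1
    ring
  · simp only [circleBranch, cond_true]
    rw [h.2.2.2 _ _ (by simpa using hst)]
    simp

theorem CircleParam.isArcAt_circleBranch (h : CircleParam S L φ) (x : ℝ) (b : Bool) :
    IsArcAt (φ x) (circleBranch φ x b) := by
  refine ⟨circleBranch_zero φ x b, L / 2, half_pos h.1, fun s hs t ht => ?_⟩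
  exact h.dist_circleBranch x b (abs_sub_le_iff.2 ⟨by linarith [hs.2, ht.1],
    by linarith [hs.1, ht.2]⟩)

theorem CircleParam.circleBranch_ne (h : CircleParam S L φ) (x : ℝ) {s : ℝ} (hs : 0 < s)
    (hsL : s ≤ L / 4) {b b' : Bool} (hb : b ≠ b') :
    circleBranch φ x b s ≠ circleBranch φ x b' s := by
  have key : circleBranch φ x true s ≠ circleBranch φ x false s := by
    have hd := h.2.2.2 (x + s) (x + -s)
      (by rw [show x + s - (x + -s) = 2 * s by ring, abs_of_pos (by linarith)]; linarith)
    rw [show x + s - (x + -s) = 2 * s by ring, abs_of_pos (by linarith)] at hd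
    rw [← dist_pos]
    simp only [circleBranch, cond_true, cond_false, hd]
    linarith
  cases b <;> cases b' <;> simp_all [key.symm]

theorem CircleParam.exists_eq_circleBranch (h : CircleParam S L φ) (x : ℝ) {Q : Γ} (hQ : Q ∈ S) :
    ∃ b, Q = circleBranch φ x b (dist Q (φ x)) := by
  obtain ⟨y, hy, rfl⟩ := h.exists_mem_Ico hQ (x - L / 2)
  rw [h.2.2.2 y x (abs_sub_le_iff.2 ⟨by linarith [hy.2], by linarith [hy.1]⟩)]
  rcases le_total x y with hxy | hxy
  · exact ⟨true, by simp [circleBranch, abs_of_nonneg (sub_nonneg.2 hxy)]⟩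
  · exact ⟨false, by simp [circleBranch, abs_of_nonpos (sub_nonpos.2 hxy)]⟩

end Circle

section CircleCover

variable {Γ ι : Type*} [MetricSpace Γ] {S : ι → Set Γ} {L : ι → ℝ} {φ : ι → ℝ → Γ}

/-- A metric space covered by metric circles, any two of which share at most one point. -/
structure IsCircleCover (S : ι → Set Γ) (L : ι → ℝ) (φ : ι → ℝ → Γ) : Prop where
  param : ∀ j, CircleParam (S j) (L j) (φ j)
  cover : ∀ P, ∃ j, P ∈ S j
  inter : ∀ j k, j ≠ k → (S j ∩ S k).Subsingleton

theorem IsCircleCover.continuous [Finite ι] (h : IsCircleCover S L φ) {f : Γ → ℝ}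
    (hf : ∀ j, Continuous (f ∘ φ j)) : Continuous f := by
  refine continuous_iff_isClosed.2 fun C hC => ?_
  have : f ⁻¹' C = ⋃ j, φ j '' (Icc 0 (L j) ∩ (f ∘ φ j) ⁻¹' C) := by
    ext P
    simp only [mem_preimage, mem_iUnion]
    constructor
    · intro hP
      obtain ⟨j, hj⟩ := h.cover P
      rw [← (h.param j).image_Icc] at hj
      obtain ⟨t, ht, rfl⟩ := hj
      exact ⟨j, t, ⟨ht, hP⟩, rfl⟩
    · rintro ⟨j, t, ⟨-, ht⟩, rfl⟩
      exact ht
  rw [this]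
  exact isClosed_iUnion_of_finite fun j =>
    ((isCompact_Icc.inter_right (hC.preimage (hf j))).image (h.param j).continuous).isClosed

theorem IsCircleCover.circleBranch_ne (h : IsCircleCover S L φ) {P : Γ} {x : ι → ℝ}
    {k k' : ι × Bool} (hk : φ k.1 (x k.1) = P) (hk' : φ k'.1 (x k'.1) = P) (hne : k ≠ k')
    {s : ℝ} (hs : 0 < s) (hsL : s ≤ L k.1 / 4) :
    circleBranch (φ k.1) (x k.1) k.2 s ≠ circleBranch (φ k'.1) (x k'.1) k'.2 s := by
  obtain ⟨j, b⟩ := k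
  obtain ⟨j', b'⟩ := k'
  simp only at hk hk' hsL ⊢
  rcases eq_or_ne j j' with rfl | hj
  · exact (h.param j).circleBranch_ne (x j) hs hsL fun hb => hne (by rw [hb])
  · intro he
    have hP : P ∈ S j ∩ S j' := ⟨hk ▸ (h.param j).mem _, hk' ▸ (h.param j').mem _⟩
    have hQ : circleBranch (φ j) (x j) b s ∈ S j ∩ S j' :=
      ⟨(h.param j).circleBranch_mem _ _ _, he ▸ (h.param j').circleBranch_mem _ _ _⟩
    have hL := (h.param j).1
    have hd := (h.param j).dist_circleBranch (x j) b (s := s) (t := 0)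
      (by rw [sub_zero, abs_of_pos hs]; linarith)
    rw [circleBranch_zero, hk, h.inter j j' hj hQ hP, dist_self, sub_zero, abs_of_pos hs] at hd
    exact hs.ne hd

theorem IsCircleCover.exists_arcEquiv [Finite ι] (h : IsCircleCover S L φ) {P : Γ} {x : ι → ℝ}
    (hx : ∀ j, P ∈ S j → φ j (x j) = P) {σ : ℝ → Γ} (hσ : IsArcAt P σ) :
    ∃ j b, P ∈ S j ∧ ArcEquiv σ (circleBranch (φ j) (x j) b) := by
  obtain ⟨h0, a, ha, hd⟩ := hσ
  have hdP : ∀ t ∈ Icc 0 a, dist (σ t) P = t := fun t ht => by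
    rw [← h0, hd t ht 0 ⟨le_rfl, ha.le⟩, sub_zero, abs_of_nonneg ht.1]
  have hev : ∀ᶠ t in 𝓝[≥] (0 : ℝ), t ≤ a := by
    filter_upwards [Icc_mem_nhdsGE ha] with t ht using ht.2
  have htend : Tendsto σ (𝓝[≥] 0) (𝓝 P) := by
    rw [tendsto_iff_dist_tendsto_zero]
    have : Tendsto (fun t : ℝ => t) (𝓝[≥] 0) (𝓝 0) := tendsto_id.mono_left nhdsWithin_le_nhds
    refine this.congr' ?_
    filter_upwards [Icc_mem_nhdsGE ha] with t ht using (hdP t ht).symm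
  have hsmall : ∀ᶠ t in 𝓝[≥] (0 : ℝ), ∀ j, (P ∉ S j → σ t ∉ S j) ∧ t ≤ L j / 4 := by
    refine eventually_all.2 fun j => Eventually.and ?_ ?_
    · by_cases hj : P ∈ S j
      · exact Eventually.of_forall fun t h' => absurd hj h'
      · filter_upwards [htend ((h.param j).isClosed.isOpen_compl.mem_nhds hj)] with t ht _
        exact ht
    · have hL := (h.param j).1
      filter_upwards [Icc_mem_nhdsGE (show (0 : ℝ) < L j / 4 by positivity)] with t ht using ht.2
  obtain ⟨ε, hε, hεs⟩ := mem_nhdsGE_iff_exists_Icc_subset.1 (hev.and hsmall)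
  have : PreconnectedSpace (Ioc 0 ε) := Subtype.preconnectedSpace isPreconnected_Ioc
  have hσc : Continuous fun t : Ioc 0 ε => σ t := by
    refine (Isometry.of_dist_eq fun s t => ?_).continuous
    have hs' := hεs (Ioc_subset_Icc_self s.2)
    have ht' := hεs (Ioc_subset_Icc_self t.2)
    rw [hd _ ⟨s.2.1.le, hs'.1⟩ _ ⟨t.2.1.le, ht'.1⟩]
    rfl
  let K := {k : ι × Bool // P ∈ S k.1}
  let A : K → Set (Ioc 0 ε) := fun k => {t | σ t = circleBranch (φ k.1.1) (x k.1.1) k.1.2 t}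
  have hAcl : ∀ k, IsClosed (A k) := fun k =>
    isClosed_eq hσc (((h.param _).continuous_circleBranch _ _).comp continuous_subtype_val)
  have hAcov : ∀ t, ∃ k, t ∈ A k := fun t => by
    have ht' := hεs (Ioc_subset_Icc_self t.2)
    obtain ⟨j, hj⟩ := h.cover (σ t)
    have hPj : P ∈ S j := by
      by_contra hP
      exact (ht'.2 j).1 hP hj
    obtain ⟨b, hb⟩ := (h.param j).exists_eq_circleBranch (x j) hj
    rw [hx j hPj, hdP _ ⟨t.2.1.le, ht'.1⟩] at hb
    exact ⟨⟨(j, b), hPj⟩, hb⟩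
  obtain ⟨k, hk⟩ := hAcov ⟨ε, hε, le_rfl⟩
  have hcompl : (A k)ᶜ = ⋃ k' : {k' // k' ≠ k}, A k' := by
    ext t
    simp only [mem_compl_iff, mem_iUnion]
    constructor
    · intro ht
      obtain ⟨k', hk'⟩ := hAcov t
      exact ⟨⟨k', fun he => ht (by rwa [← he])⟩, hk'⟩
    · rintro ⟨⟨k', hne⟩, hk'⟩ ht
      refine h.circleBranch_ne (hx _ k.2) (hx _ k'.2) (fun he => hne (Subtype.ext he.symm)) t.2.1
        ((hεs (Ioc_subset_Icc_self t.2)).2 _).2 ?_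
      exact (show σ t = _ from ht).symm.trans hk'
  have hAuniv : A k = univ := by
    refine IsClopen.eq_univ ⟨hAcl k, ?_⟩ ⟨_, hk⟩
    rw [← isClosed_compl_iff, hcompl]
    exact isClosed_iUnion_of_finite fun _ => hAcl _
  refine ⟨k.1.1, k.1.2, k.2, ε, hε, fun t ht => ?_⟩
  rcases ht.1.eq_or_lt with rfl | htpos
  · rw [h0, circleBranch_zero, hx _ k.2]
  · have : (⟨t, htpos, ht.2⟩ : Ioc 0 ε) ∈ A k := hAuniv ▸ mem_univ _
    exact this

open Classical in
theorem IsCircleCover.hasOrderAt [Fintype ι] (h : IsCircleCover S L φ) {f : Γ → ℝ} {P : Γ}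
    {x : ι → ℝ} (hx : ∀ j, P ∈ S j → φ j (x j) = P) {s : ι → Bool → ℤ}
    (hs : ∀ j, P ∈ S j → ∀ b, HasSlopeAlong f (circleBranch (φ j) (x j) b) (s j b)) :
    HasOrderAt Γ f P (∑ j, if P ∈ S j then s j true + s j false else 0) := by
  let K := {j // P ∈ S j} × Bool
  let e := Fintype.equivFin K
  let τ : K → ℝ → Γ := fun k => circleBranch (φ k.1) (x k.1) k.2
  refine ⟨Fintype.card K, fun i => τ (e.symm i), fun i => s (e.symm i).1 (e.symm i).2,
    fun i => ?_, fun i i' hii' hequiv => ?_, fun σ hσ => ?_, fun i => ?_, ?_⟩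
  · have := (h.param (e.symm i).1).isArcAt_circleBranch (x (e.symm i).1) (e.symm i).2
    rwa [hx _ (e.symm i).1.2] at this
  · obtain ⟨ε, hε, hequiv⟩ := hequiv
    set k := e.symm i
    set k' := e.symm i'
    have hkk' : ((k.1.1, k.2) : ι × Bool) ≠ (k'.1.1, k'.2) := fun he => by
      refine hii' (e.symm.injective (Prod.ext (Subtype.ext ?_) ?_))
      · exact (Prod.ext_iff.1 he).1
      · exact (Prod.ext_iff.1 he).2
    have hL := (h.param k.1).1
    have hpos : 0 < min ε (L k.1 / 4) := lt_min hε (by positivity)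
    exact h.circleBranch_ne (k := (k.1.1, k.2)) (k' := (k'.1.1, k'.2)) (hx _ k.1.2)
      (hx _ k'.1.2) hkk' hpos (min_le_right _ _) (hequiv _ ⟨hpos.le, min_le_left _ _⟩)
  · obtain ⟨j, b, hj, hjb⟩ := h.exists_arcEquiv hx hσ
    exact ⟨e (⟨j, hj⟩, b), by simpa [τ] using hjb⟩
  · exact hs _ (e.symm i).1.2 _
  · rw [e.symm.sum_comp fun k : K => s k.1 k.2, Fintype.sum_prod_type]
    simp only [Fintype.sum_bool]
    rw [← Finset.sum_filter, ← Finset.sum_subtype_eq_sum_filter]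
    simp

end CircleCover

section SidedSlopes

/-- `G` is affine on both sides of `t`, with outgoing slopes `p` to the right and `q` to the
left. -/
def HasSidedSlopes (G : ℝ → ℝ) (t p q : ℝ) : Prop :=
  (∀ᶠ s in 𝓝[≥] (0 : ℝ), G (t + s) = G t + p * s) ∧
    ∀ᶠ s in 𝓝[≥] (0 : ℝ), G (t - s) = G t + q * s

theorem eventually_le_nhdsGE_zero {δ : ℝ} (hδ : 0 < δ) :
    ∀ᶠ s in 𝓝[≥] (0 : ℝ), 0 ≤ s ∧ s ≤ δ :=
  Icc_mem_nhdsGE hδ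

theorem HasSidedSlopes.add {G H : ℝ → ℝ} {t p q p' q' : ℝ} (hG : HasSidedSlopes G t p q)
    (hH : HasSidedSlopes H t p' q') :
    HasSidedSlopes (fun s => G s + H s) t (p + p') (q + q') := by
  constructor
  · filter_upwards [hG.1, hH.1] with s h h'
    rw [h, h']
    ring
  · filter_upwards [hG.2, hH.2] with s h h'
    rw [h, h']
    ring

theorem HasSidedSlopes.const_mul {G : ℝ → ℝ} {t p q : ℝ} (hG : HasSidedSlopes G t p q) (c : ℝ) :
    HasSidedSlopes (fun s => c * G s) t (c * p) (c * q) := by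
  constructor
  · filter_upwards [hG.1] with s h
    rw [h]
    ring
  · filter_upwards [hG.2] with s h
    rw [h]
    ring

theorem HasSidedSlopes.sum {κ : Type*} (T : Finset κ) {G : κ → ℝ → ℝ} {t : ℝ} {p q : κ → ℝ}
    (hG : ∀ k, HasSidedSlopes (G k) t (p k) (q k)) :
    HasSidedSlopes (fun s => ∑ k ∈ T, G k s) t (∑ k ∈ T, p k) (∑ k ∈ T, q k) := by
  classical
  induction T using Finset.induction_on with
  | empty => simp [HasSidedSlopes]
  | insert k T hk ih => simpa only [Finset.sum_insert hk] using (hG k).add ih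

theorem hasSidedSlopes_id (t : ℝ) : HasSidedSlopes (fun s => s) t 1 (-1) :=
  ⟨Eventually.of_forall fun s => by ring, Eventually.of_forall fun s => by ring⟩

theorem hasSidedSlopes_ramp (x t : ℝ) :
    HasSidedSlopes (fun s => max 0 (s - x)) t (if x ≤ t then 1 else 0)
      (if x < t then -1 else 0) := by
  constructor
  · split_ifs with h
    · filter_upwards [eventually_le_nhdsGE_zero one_pos] with s hs
      rw [max_eq_right (by linarith), max_eq_right (by linarith)]
      ring
    · filter_upwards [eventually_le_nhdsGE_zero (sub_pos.2 (not_le.1 h))] with s hs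
      rw [max_eq_left (by linarith), max_eq_left (by linarith)]
      ring
  · split_ifs with h
    · filter_upwards [eventually_le_nhdsGE_zero (sub_pos.2 h)] with s hs
      rw [max_eq_right (by linarith), max_eq_right (by linarith)]
      ring
    · filter_upwards [eventually_le_nhdsGE_zero one_pos] with s hs
      rw [max_eq_left (by linarith), max_eq_left (by linarith)]
      ring

/-- The `L`-periodic extension of the restriction of `F` to `[0, L)`. -/
noncomputable def periodize (L : ℝ) (F : ℝ → ℝ) (t : ℝ) : ℝ := F (L * Int.fract (t / L))

theorem periodize_periodic {L : ℝ} (hL : 0 < L) (F : ℝ → ℝ) :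
    Function.Periodic (periodize L F) L := fun t => by
  simp only [periodize]
  rw [add_div, div_self hL.ne', Int.fract_add_one]

theorem periodize_eq {L : ℝ} (hL : 0 < L) (F : ℝ → ℝ) {t : ℝ} (ht : t ∈ Ico 0 L) :
    periodize L F t = F t := by
  have : Int.fract (t / L) = t / L :=
    Int.fract_eq_self.2 ⟨div_nonneg ht.1 hL.le, (div_lt_one hL).2 ht.2⟩
  rw [periodize, this, mul_div_cancel₀ _ hL.ne']

theorem continuous_periodize {L : ℝ} {F : ℝ → ℝ} (hF : Continuous F) (h0 : F 0 = F L) :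
    Continuous (periodize L F) := by
  have h : Continuous ((fun u => F (L * u)) ∘ Int.fract) :=
    ContinuousOn.comp_fract'' (f := fun u => F (L * u)) (by fun_prop) (by simp [h0])
  exact h.comp (continuous_id.div_const L)

theorem HasSidedSlopes.periodize {L : ℝ} (hL : 0 < L) {F : ℝ → ℝ} {t p q : ℝ}
    (ht : t ∈ Ioo 0 L) (hF : HasSidedSlopes F t p q) : HasSidedSlopes (periodize L F) t p q := by
  constructor
  · filter_upwards [hF.1, eventually_le_nhdsGE_zero (half_pos (sub_pos.2 ht.2))] with s h hs
    rw [periodize_eq hL F ⟨ht.1.le, ht.2⟩,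
      periodize_eq hL F ⟨by linarith [ht.1], by linarith [ht.2]⟩, h]
  · filter_upwards [hF.2, eventually_le_nhdsGE_zero ht.1] with s h hs
    rw [periodize_eq hL F ⟨ht.1.le, ht.2⟩,
      periodize_eq hL F ⟨by linarith, by linarith [ht.2]⟩, h]

theorem HasSidedSlopes.periodize_zero {L : ℝ} (hL : 0 < L) {F : ℝ → ℝ} {p q p' q' : ℝ}
    (h0 : F 0 = F L) (hF : HasSidedSlopes F 0 p q) (hF' : HasSidedSlopes F L p' q') :
    HasSidedSlopes (_root_.periodize L F) 0 p q' := by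
  have hz : _root_.periodize L F 0 = F 0 := periodize_eq hL F ⟨le_rfl, hL⟩
  constructor
  · filter_upwards [hF.1, eventually_le_nhdsGE_zero (half_pos hL)] with s h hs
    rw [hz, periodize_eq hL F ⟨by linarith, by linarith⟩, h]
  · filter_upwards [hF'.2, eventually_le_nhdsGE_zero (half_pos hL)] with s h hs
    rcases hs.1.eq_or_lt with rfl | hpos
    · simp
    · rw [hz, ← periodize_periodic hL F, periodize_eq hL F ⟨by linarith, by linarith⟩,
        show 0 - s + L = L - s by ring, h, h0]

/-- On a circle of length `L`, a divisor `∑ n k · x k` of degree `d` is equivalent to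
`(d - 1) · 0 + r` for some point `r`. -/
theorem exists_periodic_hasSidedSlopes {L : ℝ} (hL : 0 < L) {κ : Type*} (T : Finset κ)
    (x : κ → ℝ) (n : κ → ℤ) (hx : ∀ k ∈ T, x k ∈ Ico 0 L) :
    ∃ (G : ℝ → ℝ) (r : ℝ), Continuous G ∧ Function.Periodic G L ∧ r ∈ Ico 0 L ∧
      ∀ t ∈ Ico 0 L, ∃ p q : ℤ, HasSidedSlopes G t p q ∧
        p + q = (if r = t then 1 else 0) - (∑ k ∈ T, if x k = t then n k else 0) +
          (if 0 = t then ∑ k ∈ T, n k - 1 else 0) := by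
  set M : ℝ := ∑ k ∈ T, n k * (L - x k) with hM
  set c : ℤ := -⌊-M / L⌋ - 1 with hc
  set r : ℝ := L * Int.fract (-M / L) with hr
  have hr0 : 0 ≤ r := mul_nonneg hL.le (Int.fract_nonneg _)
  have hrL : r < L := by
    have := mul_lt_mul_of_pos_left (Int.fract_lt_one (-M / L)) hL
    rwa [mul_one] at this
  have hMr : c * L + (L - r) = M := by
    have h1 : r = -M - L * ⌊-M / L⌋ := by
      rw [hr, ← Int.self_sub_floor, mul_sub, mul_div_cancel₀ _ hL.ne']
    rw [h1, hc]
    push_cast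
    ring
  let F : ℝ → ℝ := fun t =>
    c * t + max 0 (t - r) + -1 * ∑ k ∈ T, n k * max 0 (t - x k)
  have hF0 : F 0 = 0 := by
    have : ∑ k ∈ T, (n k : ℝ) * max 0 (0 - x k) = 0 :=
      Finset.sum_eq_zero fun k hk => by rw [max_eq_left (by linarith [(hx k hk).1]), mul_zero]
    simp only [F, this]
    rw [max_eq_left (by linarith)]
    ring
  have hFL : F L = 0 := by
    have : ∑ k ∈ T, (n k : ℝ) * max 0 (L - x k) = M :=
      Finset.sum_congr rfl fun k hk => by rw [max_eq_right (by linarith [(hx k hk).2])]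
    simp only [F, this]
    rw [max_eq_right (by linarith)]
    linarith
  have hF : ∀ t, HasSidedSlopes F t
      ((c + (if r ≤ t then 1 else 0) - ∑ k ∈ T, if x k ≤ t then n k else 0 : ℤ) : ℝ)
      ((-c - (if r < t then 1 else 0) + ∑ k ∈ T, if x k < t then n k else 0 : ℤ) : ℝ) := by
    intro t
    have := (((hasSidedSlopes_id t).const_mul c).add (hasSidedSlopes_ramp r t)).add
      ((HasSidedSlopes.sum T fun k => (hasSidedSlopes_ramp (x k) t).const_mul (n k)).const_mul (-1))
    convert this using 1
    · push_cast
      simp only [mul_ite, mul_one, mul_zero]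
      ring
    · push_cast
      simp only [mul_ite, mul_one, mul_zero, mul_neg, neg_mul, one_mul]
      rw [← Finset.sum_neg_distrib]
      have : ∀ k, -(if x k < t then -(n k : ℝ) else 0) = if x k < t then (n k : ℝ) else 0 :=
        fun k => by split_ifs <;> simp
      simp only [this]
      split_ifs <;> ring
  refine ⟨periodize L F, r, continuous_periodize (by fun_prop) (hF0.trans hFL.symm),
    periodize_periodic hL F, ⟨hr0, hrL⟩, fun t ht => ?_⟩
  rcases ht.1.eq_or_lt with rfl | htpos
  · refine ⟨_, _, (hF 0).periodize_zero hL (hF0.trans hFL.symm) (hF L), ?_⟩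
    have h1 : (∑ k ∈ T, if x k ≤ 0 then n k else 0) = ∑ k ∈ T, if x k = 0 then n k else 0 :=
      Finset.sum_congr rfl fun k hk => by
        simp only [le_antisymm_iff, (hx k hk).1, and_true]
    have h2 : (∑ k ∈ T, if x k < L then n k else 0) = ∑ k ∈ T, n k :=
      Finset.sum_congr rfl fun k hk => if_pos (hx k hk).2
    have h3 : r ≤ 0 ↔ r = 0 := ⟨fun h => le_antisymm h hr0, le_of_eq⟩
    rw [h1, h2, if_pos hrL, if_pos rfl]
    simp only [h3]
    ring
  · refine ⟨_, _, (hF t).periodize hL ⟨htpos, ht.2⟩, ?_⟩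
    have h1 : (∑ k ∈ T, if x k ≤ t then n k else 0) =
        (∑ k ∈ T, if x k < t then n k else 0) + ∑ k ∈ T, if x k = t then n k else 0 := by
      rw [← Finset.sum_add_distrib]
      refine Finset.sum_congr rfl fun k _ => ?_
      rcases lt_trichotomy (x k) t with h | h | h
      · simp [h, h.le, h.ne]
      · simp [h]
      · simp [h.not_ge, h.not_gt, h.ne']
    have h2 : (if r ≤ t then 1 else 0 : ℤ) = (if r < t then 1 else 0) + if r = t then 1 else 0 := by
      rcases lt_trichotomy r t with h | h | h
      · simp [h, h.le, h.ne]
      · simp [h]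
      · simp [h.not_ge, h.not_gt, h.ne']
    rw [h1, h2, if_neg htpos.ne]
    ring

end SidedSlopes

section Reduction

theorem CircleParam.exists_lift {Γ : Type*} [MetricSpace Γ] {S : Set Γ} {L : ℝ} {φ : ℝ → Γ}
    (h : CircleParam S L φ) {G : ℝ → ℝ} (hG : Function.Periodic G L) :
    ∃ g : Γ → ℝ, ∀ t, g (φ t) = G t := by
  have hfac : G.FactorsThrough φ := fun s t hst => by
    have hper : Function.Periodic (fun u => (φ u, G u)) L := fun u =>
      Prod.ext (h.periodic u) (hG u)
    obtain ⟨s', hs', hss'⟩ := hper.exists_mem_Ico₀ h.1 s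
    obtain ⟨t', ht', htt'⟩ := hper.exists_mem_Ico₀ h.1 t
    rw [Prod.mk.injEq] at hss' htt'
    rw [hss'.2, htt'.2, h.injOn hs' ht' (hss'.1.symm.trans (hst.trans htt'.1))]
  exact ⟨Function.extend φ G 0, hfac.extend_apply 0⟩

theorem HasSidedSlopes.hasSlopeAlong {Γ : Type*} {f : Γ → ℝ} {φ : ℝ → Γ} {t : ℝ} {p q : ℤ}
    (h : HasSidedSlopes (f ∘ φ) t p q) (b : Bool) :
    HasSlopeAlong f (circleBranch φ t b) (bif b then p else q) := by
  rw [hasSlopeAlong_iff_eventually, circleBranch_zero]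
  cases b
  · simpa only [circleBranch, Function.comp_apply, cond_false, ← sub_eq_add_neg] using h.2
  · simpa only [circleBranch, Function.comp_apply, cond_true] using h.1

variable {Γ ι : Type*} [MetricSpace Γ] {S : ι → Set Γ} {L : ι → ℝ} {φ : ι → ℝ → Γ}

theorem IsCircleCover.linEquiv_refl [Finite ι] (h : IsCircleCover S L φ) (D : Divisor Γ) :
    LinEquiv Γ D D := by
  have := Fintype.ofFinite ι
  have ho : ∀ P, HasOrderAt Γ (0 : Γ → ℝ) P 0 := fun P => by
    have hx : ∀ j, P ∈ S j → ∃ t, φ j t = P := fun j hj => by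
      obtain ⟨t, -, ht⟩ := (h.param j).exists_mem_Ico hj 0
      exact ⟨t, ht⟩
    choose! x hx using hx
    have := h.hasOrderAt hx (f := 0) (s := 0) fun j _ b => ⟨1, one_pos, by simp⟩
    simpa using this
  exact ⟨0, isRational_of_hasOrderAt continuous_const fun P => ⟨0, ho P⟩, fun P => by
    rw [sub_self]
    exact ho P⟩

/-- If functions on the circle `S i` extend to functions constant on each other circle, then the
part of an effective divisor on `S i` can be moved to the base point `φ i 0`, up to one point. -/
theorem IsCircleCover.exists_linEquiv [Finite ι] (h : IsCircleCover S L φ) (i : ι)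
    (hext : ∀ g : Γ → ℝ, ∃ f : Γ → ℝ, (∀ P ∈ S i, f P = g P) ∧
      ∀ j, j ≠ i → ∃ c, ∀ P ∈ S j, f P = c) {D : Divisor Γ} (hD : Effective D) :
    ∃ D' : Divisor Γ, Effective D' ∧ LinEquiv Γ D D' ∧ (∀ P ∉ S i, D' P = D P) ∧
      ∃ q, ∀ P ∈ S i, D' P ≠ 0 → P = φ i 0 ∨ P = q := by
  classical
  have := Fintype.ofFinite ι
  have hθ : ∀ j P, P ∈ S j → ∃ t, t ∈ Ico 0 (L j) ∧ φ j t = P := fun j P hP => by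
    simpa using (h.param j).exists_mem_Ico hP 0
  choose! θ hθI hθ using hθ
  let T := D.support.filter (· ∈ S i)
  have hTS : ∀ P ∈ T, P ∈ S i := fun P hP => (Finset.mem_filter.1 hP).2
  let d : ℤ := ∑ P ∈ T, D P
  have hd0 : 0 ≤ d := Finset.sum_nonneg fun P _ => hD P
  rcases hd0.eq_or_lt with hd0 | hdpos
  · refine ⟨D, hD, h.linEquiv_refl D, fun _ _ => rfl, φ i 0, fun P hP hne => absurd ?_ hne⟩
    exact (Finset.sum_eq_zero_iff_of_nonneg fun P _ => hD P).1 hd0.symm P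
      (Finset.mem_filter.2 ⟨Finsupp.mem_support_iff.2 hne, hP⟩)
  obtain ⟨G, r, hGc, hGp, hr, hG⟩ := exists_periodic_hasSidedSlopes (h.param i).1 T (θ i) D
    fun P hP => hθI i P (hTS P hP)
  obtain ⟨g, hg⟩ := (h.param i).exists_lift hGp
  obtain ⟨f, hfi, hfj⟩ := hext g
  have hfφ : f ∘ φ i = G := funext fun t => (hfi _ ((h.param i).mem t)).trans (hg t)
  have hfc : ∀ j, j ≠ i → ∃ c, f ∘ φ j = fun _ => c := fun j hj => by
    obtain ⟨c, hc⟩ := hfj j hj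
    exact ⟨c, funext fun t => hc _ ((h.param j).mem t)⟩
  let D' : Divisor Γ := D.filter (· ∉ S i) + Finsupp.single (φ i r) 1 +
    Finsupp.single (φ i 0) (d - 1)
  have hD'out : ∀ P ∉ S i, D' P = D P := fun P hP => by
    have h1 : φ i r ≠ P := fun he => hP (he ▸ (h.param i).mem r)
    have h2 : φ i 0 ≠ P := fun he => hP (he ▸ (h.param i).mem 0)
    simp [D', hP, h1, h2]
  have hD'in : ∀ P ∈ S i, D' P =
      (if φ i r = P then 1 else 0) + if φ i 0 = P then d - 1 else 0 := fun P hP => by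
    simp only [D', Finsupp.add_apply, Finsupp.single_apply,
      Finsupp.filter_apply, hP, not_true_eq_false, if_false, zero_add]
  have ho : ∀ P, HasOrderAt Γ f P (D' P - D P) := fun P => by
    by_cases hP : P ∈ S i
    · obtain ⟨p, q, hpq, hsum⟩ := hG (θ i P) (hθI i P hP)
      have := h.hasOrderAt (f := f) (P := P) (x := fun j => θ j P) (fun j => hθ j P)
        (s := fun j b => if j = i then bif b then p else q else 0) fun j hj b => by
          by_cases hji : j = i
          · subst hji
            simp only [if_true]
            exact HasSidedSlopes.hasSlopeAlong (hfφ ▸ hpq) b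
          · obtain ⟨c, hc⟩ := hfc j hji
            exact ⟨1, one_pos, fun t _ => by
              simp only [hji, if_false, Int.cast_zero, zero_mul, add_zero]
              exact (congrFun hc _).trans (congrFun hc _).symm⟩
      convert this using 1
      rw [Finset.sum_eq_single i (fun j _ hj => by simp [hj]) (by simp), if_pos hP]
      simp only [if_true, cond_true, cond_false]
      have hinj : ∀ t ∈ Ico 0 (L i), (t = θ i P ↔ φ i t = P) := fun t ht =>
        ⟨fun he => he ▸ hθ i P hP, fun he =>
          (h.param i).injOn ht (hθI i P hP) (he.trans (hθ i P hP).symm)⟩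
      have hsumD : (∑ Q ∈ T, if θ i Q = θ i P then D Q else 0) = D P := by
        have : ∀ Q ∈ T, (if θ i Q = θ i P then D Q else 0) = if Q = P then D Q else 0 :=
          fun Q hQ => by
            simp only [hinj _ (hθI i Q (hTS Q hQ)), hθ i Q (hTS Q hQ)]
        rw [Finset.sum_congr rfl this, Finset.sum_ite_eq', ite_eq_left_iff]
        intro hPT
        by_contra hne
        exact hPT (Finset.mem_filter.2 ⟨Finsupp.mem_support_iff.2 (Ne.symm hne), hP⟩)
      rw [hsum, hsumD, hD'in P hP]
      simp only [hinj r hr, hinj 0 ⟨le_rfl, (h.param i).1⟩]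
      ring
    · have := h.hasOrderAt (f := f) (P := P) (x := fun j => θ j P) (fun j => hθ j P)
        (s := 0) fun j hj b => by
          obtain ⟨c, hc⟩ := hfc j fun hji => hP (hji ▸ hj)
          exact ⟨1, one_pos, fun t _ => by
            simp only [Pi.zero_apply, Int.cast_zero, zero_mul, add_zero]
            exact (congrFun hc _).trans (congrFun hc _).symm⟩
      rw [hD'out P hP]
      simpa using this
  refine ⟨D', fun P => ?_, ⟨f, isRational_of_hasOrderAt (h.continuous fun j => ?_)
    fun P => ⟨_, ho P⟩, ho⟩, hD'out, φ i r, fun P hP hne => ?_⟩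
  · by_cases hP : P ∈ S i
    · rw [hD'in P hP]
      split_ifs <;> omega
    · exact hD'out P hP ▸ hD P
  · by_cases hj : j = i
    · subst hj
      exact hfφ ▸ hGc
    · obtain ⟨c, hc⟩ := hfc j hj
      exact hc ▸ continuous_const
  · rw [hD'in P hP] at hne
    by_contra! hcon
    exact hne (by simp [hcon.1.symm, hcon.2.symm])

namespace ChainOfLoops

variable {a : ℕ} (C : ChainOfLoops a)

/-- The point of the `i`-th loop to which divisors are moved: `w i`, or `vg'` on the last loop. -/
noncomputable def base (i : ℕ) : C.Γ := if i = a then C.vg' else C.w i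

theorem loop_inter_of_lt {i j : ℕ} (hi : 1 ≤ i) (hij : i < j) (hj : j ≤ a) {P : C.Γ}
    (hPi : P ∈ C.loop i) (hPj : P ∈ C.loop j) : j = i + 1 ∧ P = C.w i := by
  rcases Nat.lt_or_ge j (i + 2) with h | h
  · obtain rfl : j = i + 1 := by omega
    have hm := C.chainMeet i (Finset.mem_Icc.2 ⟨hi, by omega⟩)
    exact ⟨rfl, (hm ▸ ⟨hPi, hPj⟩ : P ∈ ({C.w i} : Set C.Γ))⟩
  · have hm := C.chainDisj i (Finset.mem_Icc.2 ⟨hi, by omega⟩) j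
      (Finset.mem_Icc.2 ⟨by omega, hj⟩) h
    exact (hm ▸ (⟨hPi, hPj⟩ : P ∈ C.loop i ∩ C.loop j) : P ∈ (∅ : Set C.Γ)).elim

theorem base_mem {i : ℕ} (hi : i ∈ Finset.Icc 1 a) : C.base i ∈ C.loop i := by
  rw [Finset.mem_Icc] at hi
  unfold base
  split_ifs with h
  · exact h ▸ C.hvg'
  · have hm := C.chainMeet i (Finset.mem_Icc.2 ⟨hi.1, by omega⟩)
    exact (hm ▸ mem_singleton _ : C.w i ∈ C.loop i ∩ C.loop (i + 1)).1

theorem exists_isCircleCover : ∃ (L : Finset.Icc 1 a → ℝ) (φ : Finset.Icc 1 a → ℝ → C.Γ),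
    IsCircleCover (fun j : Finset.Icc 1 a => C.loop j) L φ ∧ ∀ j, φ j 0 = C.base j := by
  choose L φ hφ hφ0 using fun j : Finset.Icc 1 a =>
    (C.circle j j.2).exists_param_eq (C.base_mem j.2)
  refine ⟨L, φ, ⟨hφ, fun P => ?_, fun j k hjk => ?_⟩, hφ0⟩
  · have hP : P ∈ ⋃ i ∈ Finset.Icc 1 a, C.loop i := C.cover ▸ mem_univ P
    simp only [mem_iUnion] at hP
    obtain ⟨i, hi, hP⟩ := hP
    exact ⟨⟨i, hi⟩, hP⟩
  · have hj := Finset.mem_Icc.1 j.2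
    have hk := Finset.mem_Icc.1 k.2
    rintro P ⟨hPj, hPk⟩ Q ⟨hQj, hQk⟩
    rcases lt_or_gt_of_ne fun he : (j : ℕ) = k => hjk (Subtype.ext he) with hlt | hlt
    · rw [(C.loop_inter_of_lt hj.1 hlt hk.2 hPj hPk).2, (C.loop_inter_of_lt hj.1 hlt hk.2 hQj hQk).2]
    · rw [(C.loop_inter_of_lt hk.1 hlt hj.2 hPk hPj).2, (C.loop_inter_of_lt hk.1 hlt hj.2 hQk hQj).2]

theorem exists_extension {i : ℕ} (hi : i ∈ Finset.Icc 1 a) (g : C.Γ → ℝ) :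
    ∃ f : C.Γ → ℝ, (∀ P ∈ C.loop i, f P = g P) ∧
      ∀ j ∈ Finset.Icc 1 a, j ≠ i → ∃ c, ∀ P ∈ C.loop j, f P = c := by
  classical
  rw [Finset.mem_Icc] at hi
  refine ⟨fun P => if P ∈ C.loop i then g P else
    if ∃ j, 1 ≤ j ∧ j < i ∧ P ∈ C.loop j then g (C.w (i - 1)) else g (C.w i),
    fun P hP => if_pos hP, fun j hj hji => ?_⟩
  rw [Finset.mem_Icc] at hj
  rcases lt_or_gt_of_ne hji with hlt | hlt
  · refine ⟨g (C.w (i - 1)), fun P hP => ?_⟩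
    dsimp only
    split_ifs with h1 h2
    · obtain ⟨rfl, rfl⟩ := C.loop_inter_of_lt hj.1 hlt hi.2 hP h1
      simp
    · rfl
    · exact absurd ⟨j, hj.1, hlt, hP⟩ h2
  · refine ⟨g (C.w i), fun P hP => ?_⟩
    dsimp only
    split_ifs with h1 h2
    · rw [(C.loop_inter_of_lt hi.1 hlt hj.2 h1 hP).2]
    · obtain ⟨k, hk, hki, hPk⟩ := h2
      have := (C.loop_inter_of_lt hk (hki.trans hlt) hj.2 hPk hP).1
      omega
    · rfl

theorem exists_linEquiv_subsingleton {D : Divisor C.Γ} (hD : Effective D) {k : ℕ} (hk : k ≤ a) :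
    ∃ D' : Divisor C.Γ, Effective D' ∧ LinEquiv C.Γ D D' ∧
      ∀ i ∈ Finset.Icc 1 k, Set.Subsingleton (↑D'.support ∩ (C.loop i \ {C.base i})) := by
  obtain ⟨L, φ, hcov, hφ0⟩ := C.exists_isCircleCover
  induction k with
  | zero => exact ⟨D, hD, hcov.linEquiv_refl D, by simp⟩
  | succ k ih =>
    obtain ⟨D₁, hD₁, hDD₁, hsub⟩ := ih (by omega)
    have hmem : k + 1 ∈ Finset.Icc 1 a := Finset.mem_Icc.2 ⟨by omega, hk⟩
    obtain ⟨D₂, hD₂, hD₁D₂, hout, q, hq⟩ := hcov.exists_linEquiv ⟨k + 1, hmem⟩ (fun g => by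
      obtain ⟨f, hf, hf'⟩ := C.exists_extension hmem g
      exact ⟨f, hf, fun j hj => hf' j j.2 fun he => hj (Subtype.ext he)⟩) hD₁
    refine ⟨D₂, hD₂, hDD₁.trans hD₁D₂, fun i hi => ?_⟩
    rw [Finset.mem_Icc] at hi
    rcases hi.2.eq_or_lt with rfl | hlt
    · have key : ∀ P ∈ (↑D₂.support ∩ (C.loop (k + 1) \ {C.base (k + 1)}) : Set C.Γ), P = q :=
        fun P hP => (hq P hP.2.1 (Finsupp.mem_support_iff.1 hP.1)).resolve_left fun he =>
          hP.2.2 (he.trans (hφ0 _))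
      exact fun P hP Q hQ => (key P hP).trans (key Q hQ).symm
    · refine (hsub i (Finset.mem_Icc.2 ⟨hi.1, by omega⟩)).anti fun P hP => ⟨?_, hP.2⟩
      have hP' : P ∉ C.loop (k + 1) := fun hPk => hP.2.2 <| by
        have := (C.loop_inter_of_lt hi.1 hlt hk hP.2.1 hPk).2
        rw [mem_singleton_iff, this, base, if_neg (by omega)]
      have := Finsupp.mem_support_iff.1 hP.1
      rw [hout P hP'] at this
      exact Finsupp.mem_support_iff.2 this

end ChainOfLoops

end Reduction

end ChainOfLoopsReduction

/-- In the chain of loops `Γ₀` (with marked points `v_g ∈ γ₁` and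
`v_{g-1} ∈ γ_a`), every effective divisor is linearly equivalent to an effective divisor
whose support contains at most one point of `γ_i \ {w_i}` for each `1 ≤ i ≤ a`, where
`w_a := v_{g-1}`. -/
theorem statement12 (a : ℕ) (C : ChainOfLoops a) (D : Divisor C.Γ) (hD : Effective D) :
    ∃ D' : Divisor C.Γ, Effective D' ∧ LinEquiv C.Γ D D' ∧
      ∀ i ∈ Finset.Icc 1 a,
        Set.Subsingleton
          (↑D'.support ∩ (C.loop i \ {if i = a then C.vg' else C.w i})) := by
  exact C.exists_linEquiv_subsingleton hD le_rfl
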